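/- Let L ≥ 3, let u be a real number, and consider the antisymmetric Bariev Hamiltonian on a periodic chain of 2L qubits, H = Σ_{j=0}^{2L−1} (X_j Y_{j+2} − Y_j X_{j+2})(1 + u Z_{j+1}) with indices mod 2L. Then for every complex number c, the crosscap state |Ψ(c)⟩ built from A = diag(1, c) satisfies H |Ψ(c)⟩ = 0. -/

import Mathlib

open Matrix BigOperators

/-- The site `j + k` modulo the chain length `n`. -/
def shiftSite {n : ℕ} (j : Fin n) (k : ℕ) : Fin n :=
  ⟨(j.val + k) % n, Nat.mod_lt _ (Nat.lt_of_le_of_lt (Nat.zero_le _) j.isLt)⟩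

/-- Site `j` (for `j < L`) viewed as a site of the chain of length `2*L`. -/
def lo {L : ℕ} (j : Fin L) : Fin (2 * L) := ⟨j.val, by have := j.isLt; omega⟩

/-- The antipodal site `j + L` of the chain of length `2*L`. -/
def hi {L : ℕ} (j : Fin L) : Fin (2 * L) := ⟨j.val + L, by have := j.isLt; omega⟩

/-- The crosscap state built from the `D × D` matrix `A` on a periodic chain of `2*L` sites:
its coefficient on the computational basis state `f` is `∏_{j=0}^{L-1} A (f j) (f (j+L))`. -/
noncomputable def crosscap (L D : ℕ) (A : Matrix (Fin D) (Fin D) ℂ) :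
    (Fin (2 * L) → Fin D) → ℂ :=
  fun f => ∏ j : Fin L, A (f (lo j)) (f (hi j))

/-- The translate `h(j)` of a local operator `h` of range `r`, acting on the sites
`j, j+1, …, j+r-1` (mod `n`) of a periodic chain of `n` sites, and as the identity elsewhere. -/
noncomputable def localOp {n D : ℕ} (r : ℕ)
    (h : Matrix (Fin r → Fin D) (Fin r → Fin D) ℂ) (j : Fin n) :
    Matrix (Fin n → Fin D) (Fin n → Fin D) ℂ :=
  Matrix.of fun f g =>
    h (fun k => f (shiftSite j k.val)) (fun k => g (shiftSite j k.val)) *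
      ∏ i : Fin n, if (∃ k : Fin r, i = shiftSite j k.val) ∨ f i = g i then 1 else 0

/-- The `r`-fold Kronecker power `A^{⊗r}` of a `D × D` matrix `A`. -/
noncomputable def kronPow {D : ℕ} (r : ℕ) (A : Matrix (Fin D) (Fin D) ℂ) :
    Matrix (Fin r → Fin D) (Fin r → Fin D) ℂ :=
  Matrix.of fun f g => ∏ k : Fin r, A (f k) (g k)

/-- The one-site operator `M` acting at site `j`, identity elsewhere. -/
noncomputable def oneSite {n D : ℕ} (M : Matrix (Fin D) (Fin D) ℂ) (j : Fin n) :
    Matrix (Fin n → Fin D) (Fin n → Fin D) ℂ :=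
  Matrix.of fun f g => M (f j) (g j) * ∏ i : Fin n, if i = j ∨ f i = g i then 1 else 0

/-- The Pauli matrix `X`. -/
noncomputable def PX : Matrix (Fin 2) (Fin 2) ℂ := !![0, 1; 1, 0]

/-- The Pauli matrix `Y`. -/
noncomputable def PY : Matrix (Fin 2) (Fin 2) ℂ := !![0, -Complex.I; Complex.I, 0]

/-- The Pauli matrix `Z`. -/
noncomputable def PZ : Matrix (Fin 2) (Fin 2) ℂ := !![1, 0; 0, -1]

/-- The spin raising operator `σ⁺ = |1⟩⟨0|`. -/
noncomputable def sigmaPlus : Matrix (Fin 2) (Fin 2) ℂ := !![0, 0; 1, 0]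

theorem oneSite_mulVec {n D : ℕ} (M : Matrix (Fin D) (Fin D) ℂ) (j : Fin n)
    (v : (Fin n → Fin D) → ℂ) (f : Fin n → Fin D) :
    (oneSite M j).mulVec v f = ∑ b, M (f j) b * v (Function.update f j b) := by
  classical
  simp only [Matrix.mulVec, dotProduct, oneSite, Matrix.of_apply]
  symm
  refine Finset.sum_of_injOn (fun b => Function.update f j b) ?_ ?_ ?_ ?_
  · intro a _ b _ hab
    simpa using congrFun hab j
  · intro b _
    simp
  · intro g _ hg
    have hne : ∃ i, i ≠ j ∧ f i ≠ g i := by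
      by_contra! h
      refine hg ⟨g j, by simp, ?_⟩
      funext i
      by_cases hi : i = j
      · subst hi; simp
      · simp [hi, h i hi]
    obtain ⟨i, hij, hi⟩ := hne
    rw [Finset.prod_eq_zero (Finset.mem_univ i) (by simp [hij, hi])]
    simp
  · intro b _
    rw [Finset.prod_eq_one]
    · simp
    · intro i _
      by_cases hi : i = j <;> simp [hi]

theorem oneSite_PZ_mulVec {n : ℕ} (l : Fin n) (v : (Fin n → Fin 2) → ℂ) (f : Fin n → Fin 2) :
    (oneSite PZ l).mulVec v f = (1 - 2 * ((f l).val : ℂ)) * v f := by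
  rw [oneSite_mulVec, Fin.sum_univ_two]
  have h := Function.update_eq_self l f
  generalize f l = a at h ⊢
  rcases Fin.exists_fin_two.1 ⟨a, rfl⟩ with rfl | rfl <;> simp [PZ, h]
  ring

theorem hopping_mulVec {n : ℕ} {j k : Fin n} (hjk : j ≠ k) (v : (Fin n → Fin 2) → ℂ)
    (f : Fin n → Fin 2) :
    (oneSite PX j * oneSite PY k - oneSite PY j * oneSite PX k).mulVec v f =
      2 * Complex.I * ((f k).val - (f j).val) * v (f ∘ Equiv.swap j k) := by
  have hswap : f ∘ Equiv.swap j k = Function.update (Function.update f j (f k)) k (f j) := by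
    funext i
    by_cases hk : i = k
    · subst hk; simp
    · by_cases hj : i = j
      · subst hj; simp [hk]
      · simp [hk, hj, Equiv.swap_apply_of_ne_of_ne]
  rw [hswap, Matrix.sub_mulVec, ← Matrix.mulVec_mulVec, ← Matrix.mulVec_mulVec, Pi.sub_apply]
  simp only [oneSite_mulVec, Fin.sum_univ_two, Function.update_of_ne hjk.symm]
  generalize f j = a
  generalize f k = b
  fin_cases a <;> fin_cases b <;> simp [PX, PY] <;> ring

theorem bariev_term_mulVec {n : ℕ} {j l k : Fin n} (hjk : j ≠ k) (hlj : l ≠ j) (hlk : l ≠ k)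
    (u : ℂ) (v : (Fin n → Fin 2) → ℂ) (f : Fin n → Fin 2) :
    ((oneSite PX j * oneSite PY k - oneSite PY j * oneSite PX k) *
        (1 + u • oneSite PZ l)).mulVec v f =
      2 * Complex.I * ((f k).val - (f j).val) * (1 + u * (1 - 2 * ((f l).val : ℂ))) *
        v (f ∘ Equiv.swap j k) := by
  rw [← Matrix.mulVec_mulVec, hopping_mulVec hjk, Matrix.add_mulVec, Matrix.smul_mulVec,
    Matrix.one_mulVec, Pi.add_apply, Pi.smul_apply, oneSite_PZ_mulVec, Function.comp_apply,
    Equiv.swap_apply_of_ne_of_ne hlj hlk, smul_eq_mul]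
  ring

/-- The antipodal map `j ↦ j + L` on the chain of length `2 * L`. -/
def antipode {L : ℕ} (j : Fin (2 * L)) : Fin (2 * L) := shiftSite j L

theorem antipode_val {L : ℕ} (j : Fin (2 * L)) :
    (antipode j).val = if j.val < L then j.val + L else j.val - L := by
  have := j.isLt
  simp only [antipode, shiftSite]
  split_ifs
  · exact Nat.mod_eq_of_lt (by omega)
  · rw [Nat.mod_eq_sub_mod (by omega), Nat.mod_eq_of_lt (by omega)]
    omega

theorem antipode_involutive {L : ℕ} : Function.Involutive (antipode (L := L)) := by
  intro j
  have := j.isLt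
  ext
  rw [antipode_val, antipode_val]
  split_ifs <;> omega

theorem antipode_shiftSite {L : ℕ} (j : Fin (2 * L)) (k : ℕ) :
    antipode (shiftSite j k) = shiftSite (antipode j) k := by
  ext
  simp only [antipode, shiftSite, Nat.mod_add_mod]
  congr 1
  ring

theorem shiftSite_ne {n : ℕ} (j : Fin n) {a b : ℕ} (hab : a < b) (hb : b < a + n) :
    shiftSite j a ≠ shiftSite j b := by
  intro h
  have h1 : j.val + a ≡ j.val + b [MOD n] := congrArg Fin.val h
  have h2 : a ≡ b [MOD n] := Nat.ModEq.add_left_cancel' _ h1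
  have h3 := (Nat.modEq_iff_dvd' hab.le).1 h2
  have := Nat.le_of_dvd (by omega) h3
  omega

theorem shiftSite_zero {n : ℕ} (j : Fin n) : shiftSite j 0 = j := by
  ext
  simp [shiftSite, Nat.mod_eq_of_lt j.isLt]

theorem sum_eq_sum_lo_add_sum_hi {L : ℕ} (g : Fin (2 * L) → ℕ) :
    ∑ m, g m = ∑ j : Fin L, g (lo j) + ∑ j : Fin L, g (hi j) := by
  rw [← Fin.sum_congr' g (show L + L = 2 * L by ring), Fin.sum_univ_add]
  congr 1
  refine Finset.sum_congr rfl fun j _ => congrArg g ?_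
  ext
  simp [hi, Nat.add_comm]

theorem antipode_lo {L : ℕ} (j : Fin L) : antipode (lo j) = hi j := by
  ext
  simp [antipode_val, lo, hi]

open Classical in
theorem crosscap_diagonal {L : ℕ} (c : ℂ) (f : Fin (2 * L) → Fin 2) :
    crosscap L 2 (Matrix.diagonal ![1, c]) f =
      if ∀ m, f (antipode m) = f m then c ^ ((∑ m, (f m).val) / 2) else 0 := by
  split_ifs with h
  · have hhi (j : Fin L) : f (hi j) = f (lo j) := by rw [← antipode_lo, h]
    have hA (a : Fin 2) : Matrix.diagonal ![1, c] a a = c ^ a.val := by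
      fin_cases a <;> simp
    rw [sum_eq_sum_lo_add_sum_hi fun m => (f m).val]
    simp only [crosscap, hhi, hA, Finset.prod_pow_eq_pow_sum]
    congr 1
    omega
  · have hne : ∃ j : Fin L, f (lo j) ≠ f (hi j) := by
      by_contra! hall
      refine h fun m => ?_
      have := m.isLt
      by_cases hm : m.val < L
      · have h1 : m = lo ⟨m.val, hm⟩ := rfl
        rw [h1, antipode_lo, hall]
      · have h1 : m = antipode (lo ⟨m.val - L, by omega⟩) := by
          ext
          simp only [antipode_lo, hi]
          omega
        rw [h1, antipode_involutive, antipode_lo, hall]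
    obtain ⟨j, hj⟩ := hne
    exact Finset.prod_eq_zero (Finset.mem_univ j) (Matrix.diagonal_apply_ne _ hj)

theorem symmetric_comp_swap_antipode {L : ℕ} {j k : Fin (2 * L)} {f : Fin (2 * L) → Fin 2}
    (hj : antipode j ≠ j) (hk : antipode k ≠ k) (hjk : antipode j ≠ k)
    (h : ∀ m, (f ∘ Equiv.swap j k) (antipode m) = (f ∘ Equiv.swap j k) m) :
    f (antipode j) = f k ∧ f (antipode k) = f j ∧
      (∀ l, l ≠ j → l ≠ k → antipode l ≠ j → antipode l ≠ k → f (antipode l) = f l) ∧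
      ∀ m, (f ∘ Equiv.swap (antipode j) (antipode k)) (antipode m) =
        (f ∘ Equiv.swap (antipode j) (antipode k)) m := by
  have hkj : antipode k ≠ j := fun e => hjk (by rw [← e, antipode_involutive])
  have h1 : f (antipode j) = f k := by
    simpa [Equiv.swap_apply_of_ne_of_ne hj hjk] using h j
  have h2 : f (antipode k) = f j := by
    simpa [Equiv.swap_apply_of_ne_of_ne hkj hk] using h k
  have h3 : ∀ l, l ≠ j → l ≠ k → antipode l ≠ j → antipode l ≠ k → f (antipode l) = f l := by
    intro l a b c d
    simpa [Equiv.swap_apply_of_ne_of_ne a b, Equiv.swap_apply_of_ne_of_ne c d] using h l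
  refine ⟨h1, h2, h3, fun m => ?_⟩
  simp only [Function.comp_apply]
  have inj : ∀ a b : Fin (2 * L), antipode a = antipode b ↔ a = b :=
    fun a b => antipode_involutive.injective.eq_iff
  have inv : ∀ a : Fin (2 * L), antipode (antipode a) = a := antipode_involutive
  by_cases m1 : m = j
  · subst m1
    simp [Equiv.swap_apply_of_ne_of_ne hj.symm hkj.symm, h2]
  by_cases m2 : m = k
  · subst m2
    simp [Equiv.swap_apply_of_ne_of_ne hjk.symm hk.symm, h1]
  by_cases m3 : antipode m = j
  · obtain rfl : m = antipode j := by rw [← m3, inv]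
    simp [inv, Equiv.swap_apply_of_ne_of_ne hj.symm hkj.symm, h2]
  by_cases m4 : antipode m = k
  · obtain rfl : m = antipode k := by rw [← m4, inv]
    simp [inv, Equiv.swap_apply_of_ne_of_ne hjk.symm hk.symm, h1]
  have m5 : m ≠ antipode j := fun e => m3 (by rw [e, inv])
  have m6 : m ≠ antipode k := fun e => m4 (by rw [e, inv])
  rw [Equiv.swap_apply_of_ne_of_ne m5 m6, Equiv.swap_apply_of_ne_of_ne
    (by rwa [Ne, inj]) (by rwa [Ne, inj]), h3 m m1 m2 m3 m4]

theorem bariev_term_antipode {L : ℕ} (u c : ℂ) {j l k : Fin (2 * L)} (f : Fin (2 * L) → Fin 2)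
    (hj : antipode j ≠ j) (hk : antipode k ≠ k) (hjk : antipode j ≠ k)
    (hlj : l ≠ j) (hlk : l ≠ k) (hlj' : antipode l ≠ j) (hlk' : antipode l ≠ k) :
    2 * Complex.I * ((f (antipode k)).val - (f (antipode j)).val) *
        (1 + u * (1 - 2 * ((f (antipode l)).val : ℂ))) *
        crosscap L 2 (Matrix.diagonal ![1, c]) (f ∘ Equiv.swap (antipode j) (antipode k)) =
      -(2 * Complex.I * ((f k).val - (f j).val) * (1 + u * (1 - 2 * ((f l).val : ℂ))) *
        crosscap L 2 (Matrix.diagonal ![1, c]) (f ∘ Equiv.swap j k)) := by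
  rw [crosscap_diagonal, crosscap_diagonal]
  by_cases h : ∀ m, (f ∘ Equiv.swap j k) (antipode m) = (f ∘ Equiv.swap j k) m
  · obtain ⟨h1, h2, h3, h4⟩ := symmetric_comp_swap_antipode hj hk hjk h
    rw [if_pos h, if_pos h4, h1, h2, h3 l hlj hlk hlj' hlk']
    simp only [Function.comp_apply, Equiv.sum_comp _ fun m => (f m).val]
    ring
  · have h' : ¬ ∀ m, (f ∘ Equiv.swap (antipode j) (antipode k)) (antipode m) =
        (f ∘ Equiv.swap (antipode j) (antipode k)) m := by
      intro h'
      refine h ?_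
      have inv : ∀ a : Fin (2 * L), antipode (antipode a) = a := antipode_involutive
      have := (symmetric_comp_swap_antipode (by rw [inv]; exact hj.symm)
        (by rw [inv]; exact hk.symm)
        (by rw [inv]; exact fun e => hjk (by rw [e, inv])) h').2.2.2
      simpa only [inv] using this
    rw [if_neg h, if_neg h']
    simp

/-- the antisymmetric Bariev Hamiltonian
`H = Σ_j (X_j Y_{j+2} - Y_j X_{j+2})(1 + u Z_{j+1})` on a periodic chain of `2L` qubits
annihilates, for every `c ∈ ℂ`, the crosscap state `|Ψ(c)⟩` built from `A = diag(1, c)`. -/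
theorem antisymmetric_bariev_crosscap (L : ℕ) (hL : 3 ≤ L) (u : ℝ) (c : ℂ) :
    (∑ j : Fin (2 * L),
        (oneSite PX j * oneSite PY (shiftSite j 2) -
            oneSite PY j * oneSite PX (shiftSite j 2)) *
          (1 + (u : ℂ) • oneSite PZ (shiftSite j 1))).mulVec
      (crosscap L 2 (Matrix.diagonal ![1, c])) = 0 := by
  have site (j : Fin (2 * L)) (a b : ℕ) (hab : a < b) (hb : b < a + 2 * L) :
      shiftSite j a ≠ shiftSite j b := shiftSite_ne j hab hb
  have h01 (j : Fin (2 * L)) : shiftSite j 1 ≠ j := by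
    simpa only [shiftSite_zero] using (site j 0 1 (by omega) (by omega)).symm
  have h02 (j : Fin (2 * L)) : j ≠ shiftSite j 2 := by
    simpa only [shiftSite_zero] using site j 0 2 (by omega) (by omega)
  have h12 (j : Fin (2 * L)) : shiftSite j 1 ≠ shiftSite j 2 := site j 1 2 (by omega) (by omega)
  have hanti (j : Fin (2 * L)) : antipode j ≠ j := by
    simpa only [antipode, shiftSite_zero] using (site j 0 L (by omega) (by omega)).symm
  have hanti' (j : Fin (2 * L)) (a : ℕ) : antipode (shiftSite j a) = shiftSite j (a + L) := by
    ext
    simp [antipode, shiftSite, Nat.add_assoc]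
  funext f
  rw [Matrix.sum_mulVec, Finset.sum_apply, Pi.zero_apply, ← CharZero.eq_neg_self_iff,
    ← Finset.sum_neg_distrib]
  refine (Equiv.sum_comp antipode_involutive.toPerm _).symm.trans
    (Finset.sum_congr rfl fun j _ => ?_)
  rw [Function.Involutive.coe_toPerm, bariev_term_mulVec (h02 _) (h01 _) (h12 _),
    bariev_term_mulVec (h02 _) (h01 _) (h12 _), ← antipode_shiftSite, ← antipode_shiftSite]
  refine bariev_term_antipode _ c f (hanti j) (hanti _) ?_ (h01 j) (h12 j) ?_ ?_
  · exact (site j 2 L (by omega) (by omega)).symm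
  · rw [hanti']
    simpa only [shiftSite_zero] using (site j 0 (1 + L) (by omega) (by omega)).symm
  · rw [hanti']
    exact (site j 2 (1 + L) (by omega) (by omega)).symm
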